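/- Let E be a Banach space, let λ ∈ [0, 1/2), let f : ℝ^d → E be a Lebesgue measurable function, let Q ⊆ ℝ^d be a Lebesgue measurable set with 0 < |Q| < ∞, and let m ∈ E be a quasi-optimal center of oscillation of f on Q with a λ-portion disregarded. Let c ∈ E and r > 0. If |{x ∈ Q : ‖f(x) − c‖ > r}| ≤ λ|Q|, then ‖m − c‖ ≤ 3r. -/

import Mathlib

open MeasureTheory Set

/-- The least bound `ρ_λ(f;Q)`: the infimum of all `r ≥ 0` such that
`|{x ∈ Q : ‖f(x)‖ > r}| ≤ λ|Q|`. -/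
noncomputable def leastBound {E : Type*} [NormedAddCommGroup E] {d : ℕ} (lam : ℝ)
    (f : (Fin d → ℝ) → E) (Q : Set (Fin d → ℝ)) : ℝ :=
  sInf {r : ℝ | 0 ≤ r ∧ volume {x ∈ Q | r < ‖f x‖} ≤ ENNReal.ofReal lam * volume Q}

/-- The local oscillation `ω_λ(f;Q) := inf_{c ∈ E} ρ_λ(f - c; Q)`. -/
noncomputable def localOsc {E : Type*} [NormedAddCommGroup E] {d : ℕ} (lam : ℝ)
    (f : (Fin d → ℝ) → E) (Q : Set (Fin d → ℝ)) : ℝ :=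
  ⨅ c : E, leastBound lam (fun x => f x - c) Q

/-- A quasi-optimal center of oscillation of `f` on `Q` with a `λ`-portion disregarded:
any `m ∈ E` with `ρ_λ(f - m; Q) ≤ 2 ω_λ(f;Q)`. -/
def IsQuasiCenter {E : Type*} [NormedAddCommGroup E] {d : ℕ} (lam : ℝ)
    (f : (Fin d → ℝ) → E) (Q : Set (Fin d → ℝ)) (m : E) : Prop :=
  leastBound lam (fun x => f x - m) Q ≤ 2 * localOsc lam f Q

lemma leastBound_nonneg {E : Type*} [NormedAddCommGroup E] {d : ℕ} (lam : ℝ)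
    (f : (Fin d → ℝ) → E) (Q : Set (Fin d → ℝ)) : 0 ≤ leastBound lam f Q :=
  Real.sInf_nonneg fun _ hr => hr.1

lemma leastBound_le {E : Type*} [NormedAddCommGroup E] {d : ℕ} {lam r : ℝ}
    {f : (Fin d → ℝ) → E} {Q : Set (Fin d → ℝ)} (hr : 0 ≤ r)
    (h : volume {x ∈ Q | r < ‖f x‖} ≤ ENNReal.ofReal lam * volume Q) :
    leastBound lam f Q ≤ r :=
  csInf_le ⟨0, fun _ hs => hs.1⟩ ⟨hr, h⟩

lemma localOsc_le_leastBound {E : Type*} [NormedAddCommGroup E] {d : ℕ} (lam : ℝ)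
    (f : (Fin d → ℝ) → E) (Q : Set (Fin d → ℝ)) (c : E) :
    localOsc lam f Q ≤ leastBound lam (fun x => f x - c) Q :=
  ciInf_le ⟨0, by rintro _ ⟨a, rfl⟩; exact leastBound_nonneg _ _ _⟩ c

/-- Two balls that each capture all of `Q` up to a `λ`-portion, `λ < 1/2`, share a value of `f`,
so their centers are at distance at most the sum of their radii. -/
lemma norm_sub_le_add_of_volume_le {E : Type*} [NormedAddCommGroup E] {d : ℕ} {lam : ℝ}
    (hlam : lam < 1 / 2) {f : (Fin d → ℝ) → E} {Q : Set (Fin d → ℝ)}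
    (hQpos : 0 < volume Q) (hQfin : volume Q < ⊤) {m c : E} {s r : ℝ}
    (hm : volume {x ∈ Q | s < ‖f x - m‖} ≤ ENNReal.ofReal lam * volume Q)
    (hc : volume {x ∈ Q | r < ‖f x - c‖} ≤ ENNReal.ofReal lam * volume Q) :
    ‖m - c‖ ≤ s + r := by
  by_contra! hlt
  have hcover : Q ⊆ {x ∈ Q | s < ‖f x - m‖} ∪ {x ∈ Q | r < ‖f x - c‖} := by
    intro x hx
    by_cases hs : s < ‖f x - m‖
    · exact Or.inl ⟨hx, hs⟩
    · refine Or.inr ⟨hx, ?_⟩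
      have := norm_sub_le_norm_sub_add_norm_sub m (f x) c
      rw [norm_sub_rev m (f x)] at this
      linarith
  have hle : volume Q ≤ (ENNReal.ofReal lam + ENNReal.ofReal lam) * volume Q :=
    calc volume Q ≤ _ := (measure_mono hcover).trans (measure_union_le _ _)
      _ ≤ _ := add_le_add hm hc
      _ = _ := (add_mul _ _ _).symm
  have hlt_one : ENNReal.ofReal lam + ENNReal.ofReal lam < 1 := by
    have hhalf : ENNReal.ofReal lam < 2⁻¹ := by
      have heq : ENNReal.ofReal (1 / 2) = 2⁻¹ := by
        rw [one_div, ENNReal.ofReal_inv_of_pos two_pos, ENNReal.ofReal_ofNat]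
      exact heq ▸ (ENNReal.ofReal_lt_ofReal_iff one_half_pos).2 hlam
    simpa only [ENNReal.inv_two_add_inv_two] using ENNReal.add_lt_add hhalf hhalf
  have := ENNReal.mul_lt_mul_left hQpos.ne' hQfin.ne hlt_one
  rw [one_mul] at this
  exact hle.not_gt this

/-- if a ball `B(c,r)` captures all of `Q` up to a `λ`-portion, then any
quasi-optimal center of oscillation `m` satisfies `‖m - c‖ ≤ 3r`. -/
theorem quasiCenter_mem_ball {E : Type*} [NormedAddCommGroup E] [NormedSpace ℝ E]
    [CompleteSpace E] {d : ℕ} (lam : ℝ) (hlam0 : 0 ≤ lam) (hlam : lam < 1 / 2)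
    (f : (Fin d → ℝ) → E) (hf : AEStronglyMeasurable f volume)
    (Q : Set (Fin d → ℝ)) (hQmeas : MeasurableSet Q)
    (hQpos : 0 < volume Q) (hQfin : volume Q < ⊤)
    (m : E) (hm : IsQuasiCenter lam f Q m)
    (c : E) (r : ℝ) (hr : 0 < r)
    (h : volume {x ∈ Q | r < ‖f x - c‖} ≤ ENNReal.ofReal lam * volume Q) :
    ‖m - c‖ ≤ 3 * r := by
  have hosc : leastBound lam (fun x => f x - m) Q ≤ 2 * r :=
    hm.trans (mul_le_mul_of_nonneg_left
      ((localOsc_le_leastBound lam f Q c).trans (leastBound_le hr.le h)) zero_le_two)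
  have hne : {s : ℝ | 0 ≤ s ∧
      volume {x ∈ Q | s < ‖f x - m‖} ≤ ENNReal.ofReal lam * volume Q}.Nonempty := by
    refine ⟨r + ‖c - m‖, by positivity, (measure_mono ?_).trans h⟩
    rintro x ⟨hx, hlt⟩
    refine ⟨hx, ?_⟩
    have := norm_sub_le_norm_sub_add_norm_sub (f x) c m
    linarith
  refine le_of_forall_pos_lt_add fun ε hε => ?_
  obtain ⟨s, ⟨-, hs⟩, hlt⟩ := exists_lt_of_csInf_lt hne (hosc.trans_lt (lt_add_of_pos_right _ hε))
  have := norm_sub_le_add_of_volume_le hlam hQpos hQfin hs h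
  linarith
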